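/- arXiv:2012.10016 — 2 statements merged into one kernel-verified Lean document; each statement's English description precedes it below -/
import Mathlib

section
/- Let ≺ be a graded monomial order on S. For each 1 ≤ i ≤ m there is a unique f_i ∈ KΔ_≺(I) such that f_i(P_i) = 1 and f_i(P_j) = 0 for all j ≠ i. Moreover, the total degree of f_i equals v_{𝔭_i}(I), and the set F = {f_1,…,f_m} is a K-basis of KΔ_≺(I). -/
open MvPolynomial

noncomputable section

variable {K : Type*} [Field K] {s m : ℕ}

/-- Evaluation linear map at a family of points. -/
def evalMap (P : Fin m → (Fin s → K)) :
    MvPolynomial (Fin s) K →ₗ[K] (Fin m → K) :=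
  LinearMap.pi fun i => (MvPolynomial.aeval (P i)).toLinearMap

/-- Vanishing ideal of a finite family of points. -/
def vanishingIdeal (P : Fin m → (Fin s → K)) : Ideal (MvPolynomial (Fin s) K) :=
  ⨅ i, RingHom.ker (MvPolynomial.eval (P i))

/-- The linear map `φ : f ↦ ∑ i, f(P i)`. -/
def sumEval (P : Fin m → (Fin s → K)) : MvPolynomial (Fin s) K →ₗ[K] K :=
  ∑ i, (MvPolynomial.aeval (P i)).toLinearMap

/-- The leading exponent (initial monomial exponent) of a polynomial w.r.t. a monomial order. -/
def leadExpo (mo : MonomialOrder (Fin s)) (f : MvPolynomial (Fin s) K) : Fin s →₀ ℕ :=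
  mo.toSyn.symm (f.support.sup fun a => mo.toSyn a)

/-- The initial ideal of `I` w.r.t. a monomial order. -/
def initialIdeal (mo : MonomialOrder (Fin s)) (I : Ideal (MvPolynomial (Fin s) K)) :
    Ideal (MvPolynomial (Fin s) K) :=
  Ideal.span ((fun f => (monomial (leadExpo mo f) (1 : K))) '' {f | f ∈ I ∧ f ≠ 0})

/-- The set of exponents of standard monomials of `S/I`. -/
def stdMon (mo : MonomialOrder (Fin s)) (I : Ideal (MvPolynomial (Fin s) K)) :
    Set (Fin s →₀ ℕ) :=
  {a | monomial a (1 : K) ∉ initialIdeal mo I}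

/-- `K Δ_≺(I)`, the span of the standard monomials. -/
def stdSpan (mo : MonomialOrder (Fin s)) (I : Ideal (MvPolynomial (Fin s) K)) :
    Submodule K (MvPolynomial (Fin s) K) :=
  Submodule.span K ((fun a => monomial a (1 : K)) '' stdMon mo I)

/-- The space `(ker φ : L) = {g | g·f ∈ ker φ for all f ∈ L}`. -/
def colonKer (φ : MvPolynomial (Fin s) K →ₗ[K] K)
    (L : Submodule K (MvPolynomial (Fin s) K)) : Submodule K (MvPolynomial (Fin s) K) where
  carrier := {g | ∀ f ∈ L, φ (g * f) = 0}
  add_mem' := fun ha hb f hf => by rw [add_mul, map_add, ha f hf, hb f hf, add_zero]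
  zero_mem' := fun f hf => by rw [zero_mul, map_zero]
  smul_mem' := fun c a ha f hf => by rw [smul_mul_assoc, map_smul, ha f hf, smul_zero]

/-- The algebraic dual `L^⊥ = (ker φ : L) ∩ KΔ_≺(I)`. -/
def algDual (P : Fin m → (Fin s → K)) (mo : MonomialOrder (Fin s))
    (L : Submodule K (MvPolynomial (Fin s) K)) : Submodule K (MvPolynomial (Fin s) K) :=
  colonKer (sumEval P) L ⊓ stdSpan mo (vanishingIdeal P)

/-- The dual of a linear code in `K^m`. -/
def dualCode (C : Submodule K (Fin m → K)) : Submodule K (Fin m → K) where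
  carrier := {α | ∀ β ∈ C, ∑ i, α i * β i = 0}
  add_mem' := fun ha hb β hβ => by
    simp only [Pi.add_apply, add_mul, Finset.sum_add_distrib]
    rw [ha β hβ, hb β hβ, add_zero]
  zero_mem' := fun β hβ => by simp
  smul_mem' := fun c a ha β hβ => by
    simp only [Pi.smul_apply, smul_eq_mul, mul_assoc, ← Finset.mul_sum]
    rw [ha β hβ, mul_zero]

/-- Coordinatewise scaling of `K^m` by a vector `β`. -/
def scaleMap (β : Fin m → K) : (Fin m → K) →ₗ[K] (Fin m → K) :=
  LinearMap.pi fun i => β i • LinearMap.proj i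

/-- A monomial order is graded if it refines total degree. -/
def MonomialOrder.IsGraded (mo : MonomialOrder (Fin s)) : Prop :=
  ∀ a b : Fin s →₀ ℕ, Finsupp.degree a < Finsupp.degree b → mo.toSyn a < mo.toSyn b

/-- The affine Hilbert function of the vanishing ideal of the points `P`. -/
def hilbA (P : Fin m → (Fin s → K)) (d : ℕ) : ℕ :=
  Module.finrank K
    (Submodule.map (Ideal.Quotient.mkₐ K (vanishingIdeal P)).toLinearMap
      (restrictTotalDegree (Fin s) K d))

/-- The affine Hilbert function, with `H(d) = 0` for `d < 0`. -/
def hilbAZ (P : Fin m → (Fin s → K)) (d : ℤ) : ℕ :=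
  if d < 0 then 0 else hilbA P d.toNat

/-- The Reed–Muller-type code of degree `d` on the points `P`. -/
def RMcode (P : Fin m → (Fin s → K)) (d : ℕ) : Submodule K (Fin m → K) :=
  Submodule.map (evalMap P) (restrictTotalDegree (Fin s) K d)

/-- The Reed–Muller-type code indexed by an integer degree, `⊥` for `d < 0`. -/
def RMcodeZ (P : Fin m → (Fin s → K)) (d : ℤ) : Submodule K (Fin m → K) :=
  if d < 0 then ⊥ else RMcode P d.toNat

/-- The vanishing ideal of a single point. -/
def pointIdeal (Q : Fin s → K) : Ideal (MvPolynomial (Fin s) K) :=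
  RingHom.ker (MvPolynomial.eval Q)

/-- The local v-number `v_𝔭(I)`. -/
def vNumAt (I 𝔭 : Ideal (MvPolynomial (Fin s) K)) : ℕ :=
  sInf {d | ∃ f : MvPolynomial (Fin s) K, f ≠ 0 ∧ f.totalDegree = d ∧
    I.colon (Ideal.span {f}) = 𝔭}

/-- `f` is an indicator function for the `i`-th point. -/
def IsIndicator (P : Fin m → (Fin s → K)) (f : MvPolynomial (Fin s) K) (i : Fin m) : Prop :=
  MvPolynomial.eval (P i) f ≠ 0 ∧ ∀ j, j ≠ i → MvPolynomial.eval (P j) f = 0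

/-- The minimum distance of a linear code. -/
def minDist (C : Submodule K (Fin m → K)) : ℕ :=
  sInf {w | ∃ v ∈ C, v ≠ 0 ∧ Set.ncard {i | v i ≠ 0} = w}

theorem mem_vanishingIdeal {P : Fin m → (Fin s → K)} {f : MvPolynomial (Fin s) K} :
    f ∈ (vanishingIdeal P : Ideal (MvPolynomial (Fin s) K)) ↔ ∀ i, eval (P i) f = 0 := by
  simp [_root_.vanishingIdeal, RingHom.mem_ker]

theorem mem_stdMon_iff {mo : MonomialOrder (Fin s)} {I : Ideal (MvPolynomial (Fin s) K)}
    {a : Fin s →₀ ℕ} : a ∈ stdMon mo I ↔ ∀ f ∈ I, f ≠ 0 → ¬ mo.degree f ≤ a := by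
  have h : initialIdeal mo I = Ideal.span ((fun b => monomial b (1 : K)) ''
      (mo.degree '' {f | f ∈ I ∧ f ≠ 0})) := by
    rw [Set.image_image]
    rfl
  rw [stdMon, Set.mem_ofPred_eq, h, mem_ideal_span_monomial_image]
  simp

theorem mem_stdSpan_iff {mo : MonomialOrder (Fin s)} {I : Ideal (MvPolynomial (Fin s) K)}
    {f : MvPolynomial (Fin s) K} : f ∈ stdSpan mo I ↔ ∀ a ∈ f.support, a ∈ stdMon mo I := by
  rw [stdSpan, ← restrictSupport_eq_span, mem_restrictSupport_iff]
  rfl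

theorem eq_zero_of_mem_stdSpan_of_mem {mo : MonomialOrder (Fin s)}
    {I : Ideal (MvPolynomial (Fin s) K)} {f : MvPolynomial (Fin s) K}
    (hf : f ∈ stdSpan mo I) (hfI : f ∈ I) : f = 0 := by
  by_contra h0
  exact mem_stdMon_iff.1 (mem_stdSpan_iff.1 hf _ (mo.degree_mem_support h0)) f hfI h0 le_rfl

theorem MonomialOrder.IsGraded.totalDegree_le {mo : MonomialOrder (Fin s)} (hmo : mo.IsGraded)
    {f g : MvPolynomial (Fin s) K} (hg : g ≠ 0)
    (h : mo.toSyn (mo.degree f) ≤ mo.toSyn (mo.degree g)) : f.totalDegree ≤ g.totalDegree := by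
  refine Finset.sup_le fun a ha => ?_
  have hag : Finsupp.degree a ≤ Finsupp.degree (mo.degree g) := by
    by_contra! hlt
    exact (hmo _ _ hlt).not_ge ((mo.le_degree ha).trans h)
  exact hag.trans (le_totalDegree (mo.degree_mem_support hg))

/-- Every polynomial is congruent modulo `I` to a combination of standard monomials of no larger
degree. -/
theorem exists_mem_stdSpan_sub_mem {mo : MonomialOrder (Fin s)} (hmo : mo.IsGraded)
    (I : Ideal (MvPolynomial (Fin s) K)) (f : MvPolynomial (Fin s) K) :
    ∃ r ∈ stdSpan mo I, f - r ∈ I ∧ r.totalDegree ≤ f.totalDegree := by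
  rcases eq_or_ne f 0 with rfl | hf
  · exact ⟨0, zero_mem _, by simp, le_rfl⟩
  obtain ⟨g, r, hfr, hdeg, hr⟩ := mo.div_set (B := {b | b ∈ I ∧ b ≠ 0})
    (fun b hb => mo.isUnit_leadingCoeff.2 hb.2) f
  refine ⟨r, mem_stdSpan_iff.2 fun a ha => mem_stdMon_iff.2 fun b hb hb0 => hr a ha b ⟨hb, hb0⟩,
    ?_, hmo.totalDegree_le hf ?_⟩
  · rw [hfr, add_sub_cancel_right, Finsupp.linearCombination_apply]
    exact sum_mem fun b _ => I.mul_mem_left _ b.2.1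
  · rw [eq_sub_of_add_eq' hfr.symm]
    refine mo.degree_sub_le.trans (sup_le le_rfl ?_)
    rw [Finsupp.linearCombination_apply]
    refine mo.degree_sum_le.trans (Finset.sup_le fun b _ => ?_)
    simpa only [smul_eq_mul, mul_comm] using hdeg b

theorem eq_of_mem_stdSpan_of_eval_eq {P : Fin m → (Fin s → K)} {mo : MonomialOrder (Fin s)}
    {f g : MvPolynomial (Fin s) K} (hf : f ∈ stdSpan mo (vanishingIdeal P))
    (hg : g ∈ stdSpan mo (vanishingIdeal P)) (h : ∀ j, eval (P j) f = eval (P j) g) : f = g :=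
  sub_eq_zero.1 <| eq_zero_of_mem_stdSpan_of_mem (sub_mem hf hg) <|
    mem_vanishingIdeal.2 fun j => by rw [map_sub, h, sub_self]

theorem colon_vanishingIdeal_eq_pointIdeal_iff [Fintype K] {P : Fin m → (Fin s → K)}
    (hP : Function.Injective P) {f : MvPolynomial (Fin s) K} {i : Fin m} :
    (vanishingIdeal P : Ideal (MvPolynomial (Fin s) K)).colon (Ideal.span {f}) =
      pointIdeal (P i) ↔ IsIndicator P f i := by
  have hcolon (g : MvPolynomial (Fin s) K) :
      g ∈ (vanishingIdeal P : Ideal (MvPolynomial (Fin s) K)).colon (Ideal.span {f}) ↔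
        ∀ j, eval (P j) g * eval (P j) f = 0 := by
    rw [Submodule.mem_colon]
    simp only [← map_mul, ← mem_vanishingIdeal]
    refine ⟨fun h => h f (Ideal.mem_span_singleton_self f), fun h p hp => ?_⟩
    obtain ⟨q, rfl⟩ := Ideal.mem_span_singleton.1 hp
    rw [smul_eq_mul, ← mul_assoc]
    exact Ideal.mul_mem_right _ _ h
  have hpoint (g : MvPolynomial (Fin s) K) : g ∈ pointIdeal (P i) ↔ eval (P i) g = 0 := Iff.rfl
  rw [SetLike.ext_iff]
  simp only [hcolon, hpoint]
  constructor
  · intro h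
    have hz : ∀ j, j ≠ i → eval (P j) f = 0 := fun j hj => by
      have := (h (indicator (P j))).2
        (eval_indicator_apply_eq_zero _ _ (hP.ne hj.symm)) j
      rwa [eval_indicator_apply_eq_one, one_mul] at this
    refine ⟨fun h0 => one_ne_zero (α := K) ?_, hz⟩
    rw [← map_one (eval (P i))]
    refine (h 1).1 fun j => ?_
    rcases eq_or_ne j i with rfl | hj
    · rw [h0, mul_zero]
    · rw [hz j hj, mul_zero]
  · rintro ⟨hi, hz⟩ g
    refine ⟨fun h => (mul_eq_zero.1 (h i)).resolve_right hi, fun h j => ?_⟩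
    rcases eq_or_ne j i with rfl | hj
    · rw [h, zero_mul]
    · rw [hz j hj, mul_zero]

theorem exists_standard_indicator_le [Fintype K] {P : Fin m → (Fin s → K)}
    {mo : MonomialOrder (Fin s)} (hmo : mo.IsGraded) {f : MvPolynomial (Fin s) K} {i : Fin m}
    (hf : IsIndicator P f i) :
    ∃ r ∈ stdSpan mo (vanishingIdeal P), eval (P i) r = 1 ∧
      (∀ j, j ≠ i → eval (P j) r = 0) ∧ r.totalDegree ≤ f.totalDegree := by
  obtain ⟨r, hr, hsub, hdeg⟩ := exists_mem_stdSpan_sub_mem hmo (vanishingIdeal P)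
    ((eval (P i) f)⁻¹ • f)
  have hev (j) : eval (P j) r = (eval (P i) f)⁻¹ * eval (P j) f := by
    have := mem_vanishingIdeal.1 hsub j
    rw [map_sub, smul_eval, sub_eq_zero] at this
    exact this.symm
  refine ⟨r, hr, ?_, fun j hj => ?_, hdeg.trans (totalDegree_smul_le _ _)⟩
  · rw [hev, inv_mul_cancel₀ hf.1]
  · rw [hev, hf.2 j hj, mul_zero]

/-- Existence, uniqueness, degrees and basis property of standard indicator functions. -/
theorem standard_indicator_functions [Fintype K]
    (P : Fin m → (Fin s → K)) (hP : Function.Injective P) (hm : 2 ≤ m)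
    (mo : MonomialOrder (Fin s)) (hmo : mo.IsGraded) :
    (∀ i : Fin m, ∃! f : MvPolynomial (Fin s) K,
      f ∈ stdSpan mo (vanishingIdeal P) ∧ MvPolynomial.eval (P i) f = 1 ∧
        ∀ j : Fin m, j ≠ i → MvPolynomial.eval (P j) f = 0) ∧
    ∀ F : Fin m → MvPolynomial (Fin s) K,
      (∀ i : Fin m, F i ∈ stdSpan mo (vanishingIdeal P) ∧
        MvPolynomial.eval (P i) (F i) = 1 ∧
        ∀ j : Fin m, j ≠ i → MvPolynomial.eval (P j) (F i) = 0) →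
      (∀ i : Fin m,
        (F i).totalDegree = vNumAt (vanishingIdeal P) (pointIdeal (P i))) ∧
      LinearIndependent K F ∧
      Submodule.span K (Set.range F) = stdSpan mo (vanishingIdeal P) := by
  refine ⟨fun i => ?_, fun F hF => ?_⟩
  · obtain ⟨r, hr, h1, h0, -⟩ := exists_standard_indicator_le hmo (P := P) (i := i)
      (f := indicator (P i)) ⟨by simp [eval_indicator_apply_eq_one],
        fun j hj => eval_indicator_apply_eq_zero _ _ (hP.ne hj)⟩
    refine ⟨r, ⟨hr, h1, h0⟩, fun g hg => eq_of_mem_stdSpan_of_eval_eq hg.1 hr fun j => ?_⟩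
    rcases eq_or_ne j i with rfl | hj
    · rw [hg.2.1, h1]
    · rw [hg.2.2 j hj, h0 j hj]
  have hsum (c : Fin m → K) (j : Fin m) : eval (P j) (∑ i, c i • F i) = c j := by
    rw [map_sum, Finset.sum_eq_single j]
    · rw [smul_eval, (hF j).2.1, mul_one]
    · intro i _ hi
      rw [smul_eval, (hF i).2.2 j hi.symm, mul_zero]
    · simp
  refine ⟨fun i => ?_, ?_, le_antisymm ?_ fun f hf => ?_⟩
  · have hmem : (F i).totalDegree ∈ {d | ∃ f : MvPolynomial (Fin s) K, f ≠ 0 ∧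
        f.totalDegree = d ∧ (vanishingIdeal P : Ideal (MvPolynomial (Fin s) K)).colon
          (Ideal.span {f}) = pointIdeal (P i)} := by
      have h1 : eval (P i) (F i) ≠ 0 := by simp [(hF i).2.1]
      exact ⟨F i, fun h => h1 (by rw [h, map_zero]), rfl,
        (colon_vanishingIdeal_eq_pointIdeal_iff hP).2 ⟨h1, (hF i).2.2⟩⟩
    refine le_antisymm (le_csInf ⟨_, hmem⟩ ?_) (Nat.sInf_le hmem)
    rintro _ ⟨f, -, rfl, hf⟩
    obtain ⟨r, hr, h1, h0, hdeg⟩ := exists_standard_indicator_le hmo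
      ((colon_vanishingIdeal_eq_pointIdeal_iff hP).1 hf)
    rwa [eq_of_mem_stdSpan_of_eval_eq (hF i).1 hr fun j => ?_]
    rcases eq_or_ne j i with rfl | hj
    · rw [(hF j).2.1, h1]
    · rw [(hF i).2.2 j hj, h0 j hj]
  · refine Fintype.linearIndependent_iff.2 fun c hc j => ?_
    rw [← hsum c j, hc, map_zero]
  · rw [Submodule.span_le]
    rintro _ ⟨i, rfl⟩
    exact (hF i).1
  · rw [eq_of_mem_stdSpan_of_eval_eq hf
      (sum_mem fun i (_ : i ∈ Finset.univ) => Submodule.smul_mem _ (eval (P i) f) (hF i).1)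
      fun j => (hsum (fun i => eval (P i) f) j).symm]
    exact sum_mem fun i _ => Submodule.smul_mem _ _ (Submodule.subset_span ⟨i, rfl⟩)

end
end

section
/- Let I = I(X), let δ_X(d) denote the minimum distance of the Reed–Muller-type code C_X(d), let reg(δ_X) be the least integer n ≥ 0 such that δ_X(d) = 1 for all d ≥ n, and let v(I) be the v-number of I. Then v(I) = reg(δ_X) ≤ reg(H_I^a). -/
open MvPolynomial

noncomputable section

variable {K : Type*} [Field K] {s m : ℕ}

/-- The colon ideal of `I(X)` by `f` is the ideal of `P i` exactly when `f` is an indicator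
function for `P i`. -/
theorem colon_eq_pointIdeal_iff (P : Fin m → (Fin s → K)) (hP : Function.Injective P)
    (f : MvPolynomial (Fin s) K) (i : Fin m) :
    (vanishingIdeal P).colon (Ideal.span {f}) = pointIdeal (P i) ↔ IsIndicator P f i := by
  have mem_colon (g : MvPolynomial (Fin s) K) :
      g ∈ (vanishingIdeal P).colon (Ideal.span {f}) ↔
        ∀ j, eval (P j) g = 0 ∨ eval (P j) f = 0 := by
    rw [Ideal.mem_colon_span_singleton]
    simp [_root_.vanishingIdeal, RingHom.mem_ker]
  constructor
  · intro h
    have off_point : ∀ j, j ≠ i → eval (P j) f = 0 := by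
      intro j hj
      obtain ⟨k, hk⟩ := Function.ne_iff.mp (hP.ne hj)
      have hX : (X k - C (P i k) : MvPolynomial (Fin s) K) ∈ pointIdeal (P i) := by
        simp [pointIdeal, RingHom.mem_ker]
      rw [← h, mem_colon] at hX
      refine (hX j).resolve_left ?_
      simpa [sub_eq_zero] using hk
    refine ⟨fun h0 => ?_, off_point⟩
    have h1 : (1 : MvPolynomial (Fin s) K) ∈ pointIdeal (P i) := by
      rw [← h, mem_colon]
      intro j
      by_cases hj : j = i
      · exact Or.inr (hj ▸ h0)
      · exact Or.inr (off_point j hj)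
    simp [pointIdeal, RingHom.mem_ker] at h1
  · rintro ⟨hi, hj⟩
    ext g
    rw [mem_colon, pointIdeal, RingHom.mem_ker]
    refine ⟨fun h => (h i).resolve_right hi, fun h j => ?_⟩
    by_cases hji : j = i
    · exact Or.inl (hji ▸ h)
    · exact Or.inr (hj j hji)

theorem evalMap_apply (P : Fin m → (Fin s → K)) (f : MvPolynomial (Fin s) K) (i : Fin m) :
    evalMap P f i = eval (P i) f := by
  simp [evalMap]

theorem IsIndicator.ne_zero {P : Fin m → (Fin s → K)} {f : MvPolynomial (Fin s) K} {i : Fin m}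
    (h : IsIndicator P f i) : f ≠ 0 := by
  rintro rfl
  exact h.1 (map_zero _)

theorem minDist_eq_one_iff (C : Submodule K (Fin m → K)) :
    minDist C = 1 ↔ ∃ v ∈ C, Set.ncard {i | v i ≠ 0} = 1 := by
  constructor
  · intro h
    have hne := Nat.nonempty_of_sInf_eq_succ h
    obtain ⟨v, hv, -, hc⟩ := Nat.sInf_mem hne
    exact ⟨v, hv, hc.trans h⟩
  · rintro ⟨v, hv, hc⟩
    have hv0 : v ≠ 0 := by
      rintro rfl
      simp at hc
    refine (IsLeast.csInf_eq ⟨⟨v, hv, hv0, hc⟩, ?_⟩ : minDist C = 1)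
    rintro w ⟨u, -, hu, rfl⟩
    obtain ⟨k, hk⟩ := Function.ne_iff.mp hu
    exact (Set.ncard_pos (Set.toFinite _)).mpr ⟨k, hk⟩

theorem minDist_RMcode_eq_one_iff (P : Fin m → (Fin s → K)) (d : ℕ) :
    minDist (RMcode P d) = 1 ↔ ∃ i f, IsIndicator P f i ∧ f.totalDegree ≤ d := by
  rw [minDist_eq_one_iff]
  constructor
  · rintro ⟨_, ⟨f, hf, rfl⟩, hc⟩
    obtain ⟨i, hi⟩ := Set.ncard_eq_one.mp hc
    have key (j : Fin m) : eval (P j) f ≠ 0 ↔ j = i := by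
      simpa [evalMap_apply] using Set.ext_iff.mp hi j
    refine ⟨i, f, ⟨(key i).mpr rfl, fun j hj => ?_⟩, (mem_restrictTotalDegree ..).mp hf⟩
    exact not_not.mp (mt (key j).mp hj)
  · rintro ⟨i, f, ⟨hi, hj⟩, hd⟩
    refine ⟨evalMap P f, ⟨f, (mem_restrictTotalDegree ..).mpr hd, rfl⟩, ?_⟩
    refine Set.ncard_eq_one.mpr ⟨i, Set.ext fun j => ?_⟩
    simp only [evalMap_apply, Set.mem_ofPred_eq, Set.mem_singleton_iff]
    exact ⟨fun h => not_not.mp (mt (hj j) h), fun h => h ▸ hi⟩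

theorem ker_evalMap (P : Fin m → (Fin s → K)) :
    LinearMap.ker (evalMap P) = (vanishingIdeal P).restrictScalars K := by
  ext f
  simp [_root_.vanishingIdeal, RingHom.mem_ker, _root_.funext_iff, evalMap_apply]

/-- The affine Hilbert function in degree `d` is the dimension of the code of degree `d`. -/
theorem hilbA_eq_finrank_RMcode (P : Fin m → (Fin s → K)) (d : ℕ) :
    hilbA P d = Module.finrank K (RMcode P d) := by
  let L : (MvPolynomial (Fin s) K ⧸ vanishingIdeal P) →ₗ[K] (Fin m → K) :=
    ((vanishingIdeal P).restrictScalars K).liftQ (evalMap P) (ker_evalMap P).ge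
  have hL : Function.Injective L := by
    rw [← LinearMap.ker_eq_bot]
    exact Submodule.ker_liftQ_eq_bot _ _ _ (ker_evalMap P).le
  have hmap : RMcode P d = ((restrictTotalDegree (Fin s) K d).map
      (Ideal.Quotient.mkₐ K (vanishingIdeal P)).toLinearMap).map L := by
    rw [← Submodule.map_comp]
    rfl
  rw [hmap]
  exact (Submodule.equivMapOfInjective L hL _).finrank_eq

/-- If the affine Hilbert function attains `m` in degree `d`, every point has an indicator
function of degree at most `d`. -/
theorem exists_isIndicator_of_hilbA_eq (P : Fin m → (Fin s → K)) {d : ℕ} (h : hilbA P d = m)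
    (i : Fin m) : ∃ f, IsIndicator P f i ∧ f.totalDegree ≤ d := by
  have htop : RMcode P d = ⊤ := by
    apply Submodule.eq_top_of_finrank_eq
    rw [← hilbA_eq_finrank_RMcode, h, Module.finrank_fin_fun]
  obtain ⟨f, hf, he⟩ : Pi.single i (1 : K) ∈ RMcode P d := htop ▸ Submodule.mem_top
  refine ⟨f, ⟨?_, fun j hj => ?_⟩, (mem_restrictTotalDegree ..).mp hf⟩
  · rw [← evalMap_apply, he]
    simp
  · rw [← evalMap_apply, he, Pi.single_eq_of_ne hj]

/-- The v-number of `I(X)` equals the regularity index of the minimum distance function, and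
is at most the regularity index of the affine Hilbert function. -/
theorem vNumber_eq_reg_minDist [Fintype K]
    (P : Fin m → (Fin s → K)) (hP : Function.Injective P) (hm : 2 ≤ m)
    (n : ℕ) (hn : IsLeast {n' : ℕ | ∀ d : ℕ, n' ≤ d → minDist (RMcode P d) = 1} n)
    (r0 : ℕ) (hr0 : IsLeast {ℓ : ℕ | ∀ d : ℕ, ℓ ≤ d → hilbA P d = m} r0) :
    (⨅ i : Fin m, vNumAt (vanishingIdeal P) (pointIdeal (P i))) = n ∧ n ≤ r0 := by
  have attained (d : ℕ) : n ≤ d ↔ ∃ i f, IsIndicator P f i ∧ f.totalDegree ≤ d := by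
    constructor
    · intro hd
      exact (minDist_RMcode_eq_one_iff P d).mp (hn.1 d hd)
    · rintro ⟨i, f, hf, hd⟩
      exact hn.2 fun e he => (minDist_RMcode_eq_one_iff P e).mpr ⟨i, f, hf, hd.trans he⟩
  have indicator (i : Fin m) := exists_isIndicator_of_hilbA_eq P (hr0.1 r0 le_rfl) i
  have : Nonempty (Fin m) := ⟨⟨0, by omega⟩⟩
  refine ⟨le_antisymm ?_ (le_ciInf fun i => ?_), ?_⟩
  · obtain ⟨i, f, hf, hd⟩ := (attained n).mp le_rfl
    calc (⨅ i : Fin m, vNumAt (vanishingIdeal P) (pointIdeal (P i)))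
        ≤ vNumAt (vanishingIdeal P) (pointIdeal (P i)) := ciInf_le (OrderBot.bddBelow _) i
      _ ≤ f.totalDegree :=
        Nat.sInf_le ⟨f, hf.ne_zero, rfl, (colon_eq_pointIdeal_iff P hP f i).mpr hf⟩
      _ ≤ n := hd
  · obtain ⟨g, hg, -⟩ := indicator i
    refine le_csInf ⟨_, g, hg.ne_zero, rfl, (colon_eq_pointIdeal_iff P hP g i).mpr hg⟩ ?_
    rintro _ ⟨f, -, rfl, hf⟩
    exact (attained _).mpr ⟨i, f, (colon_eq_pointIdeal_iff P hP f i).mp hf, le_rfl⟩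
  · exact (attained r0).mpr ⟨_, indicator (Classical.arbitrary _)⟩

end
end
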